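/- Let (X_i)_{i≥1} be i.i.d. exponential random variables with mean 1 and, for λ > −1, let Z_{∞;λ} := sup{ (X_1 + ... + X_k)/(k + λ) : k ∈ ℕ⁺ }, with cumulative distribution function F_{∞;λ}. Then F_{∞;λ} restricted to (1, ∞) is a bijection onto (0, 1) whose inverse is F_{∞;λ}^{−1}(u) = (−log(1−u)) / ( (1+λ) (1 − (1−u)^{1/(1+λ)}) ) for all u ∈ (0, 1); equivalently, F_{∞;λ}( (−log(1−u)) / ( (1+λ)(1 − (1−u)^{1/(1+λ)}) ) ) = u for every u ∈ (0, 1). -/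

import Mathlib

open MeasureTheory ProbabilityTheory Real Set

/-- Sequences whose first `n` partial sums stay below the line `b + x k`. -/
def NC (x : ℝ) (n : ℕ) (b : ℝ) : Set (ℕ → ℝ) :=
  {z | ∀ k < n, ∑ j ∈ Finset.range (k + 1), z j ≤ b + x * k}

lemma mem_NC_succ (x : ℝ) (n : ℕ) (b : ℝ) (z : ℕ → ℝ) :
    z ∈ NC x (n + 1) b ↔ z 0 ≤ b ∧ (fun i => z (i + 1)) ∈ NC x n (b - z 0 + x) := by
  simp only [NC, mem_ofPred_eq]
  constructor
  · intro h
    refine ⟨by simpa using h 0 (by omega), fun k hk => ?_⟩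
    have := h (k + 1) (by omega)
    rw [Finset.sum_range_succ'] at this
    push_cast at this
    linarith
  · rintro ⟨h0, h⟩ k hk
    rcases k with _ | k
    · simpa using h0
    · have := h k (by omega)
      rw [Finset.sum_range_succ']
      push_cast
      linarith

lemma measurableSet_NC_aux (x : ℝ) (n : ℕ) (b : ℝ) :
    MeasurableSet {p : ℝ × (ℕ → ℝ) | p.1 ≤ b ∧ p.2 ∈ NC x n (b - p.1 + x)} := by
  have : {p : ℝ × (ℕ → ℝ) | p.1 ≤ b ∧ p.2 ∈ NC x n (b - p.1 + x)} =
      {p | p.1 ≤ b} ∩ ⋂ k : ℕ, ⋂ _ : k < n,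
        {p | ∑ j ∈ Finset.range (k + 1), p.2 j ≤ b - p.1 + x + x * k} := by
    ext p; simp [NC]
  rw [this]
  refine (measurableSet_le (by fun_prop) (by fun_prop)).inter ?_
  refine MeasurableSet.iInter fun k => MeasurableSet.iInter fun _ => ?_
  exact measurableSet_le (by fun_prop) (by fun_prop)

lemma measurableSet_NC (x : ℝ) (n : ℕ) (b : ℝ) : MeasurableSet (NC x n b) := by
  have : NC x n b = ⋂ k : ℕ, ⋂ _ : k < n,
        {z | ∑ j ∈ Finset.range (k + 1), z j ≤ b + x * k} := by
    ext p; simp [NC]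
  rw [this]
  refine MeasurableSet.iInter fun k => MeasurableSet.iInter fun _ => ?_
  exact measurableSet_le (by fun_prop) (by fun_prop)

lemma indep_tail {Ω : Type*} [MeasurableSpace Ω] {μ : Measure Ω} [IsProbabilityMeasure μ]
    (X : ℕ → Ω → ℝ) (hmeas : ∀ i, Measurable (X i)) (hindep : iIndepFun X μ) :
    IndepFun (X 0) (fun ω i => X (i + 1) ω) μ := by
  rw [IndepFun_iff_Indep]
  have h := indep_iSup_of_disjoint (fun i => (hmeas i).comap_le) hindep.iIndep
    (S := {0}) (T := Ici 1) (by simp)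
  refine indep_of_indep_of_le_left (indep_of_indep_of_le_right h ?_) ?_
  · rw [← measurable_iff_comap_le]
    refine @measurable_pi_lambda _ _ _ (_) _ _ fun i => ?_
    rw [measurable_iff_comap_le]
    exact le_iSup₂_of_le (i + 1) (by simp) le_rfl
  · exact le_iSup₂_of_le 0 (by simp) le_rfl

lemma prob_succ {Ω : Type*} [MeasurableSpace Ω] {μ : Measure Ω} [IsProbabilityMeasure μ]
    (X : ℕ → Ω → ℝ) (hmeas : ∀ i, Measurable (X i)) (hindep : iIndepFun X μ)
    (hdist : ∀ i, Measure.map (X i) μ = expMeasure 1) (x : ℝ) (n : ℕ) (b : ℝ) :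
    μ {ω | (fun i => X i ω) ∈ NC x (n + 1) b} =
      ∫⁻ y in Iic b, μ {ω | (fun i => X (i + 1) ω) ∈ NC x n (b - y + x)} ∂(expMeasure 1) := by
  have hZ : Measurable (fun ω i => X (i + 1) ω) := measurable_pi_lambda _ fun i => hmeas _
  have hm := measurableSet_NC_aux x n b
  have h1 : {ω | (fun i => X i ω) ∈ NC x (n + 1) b} =
      (fun ω => (X 0 ω, fun i => X (i + 1) ω)) ⁻¹'
        {p : ℝ × (ℕ → ℝ) | p.1 ≤ b ∧ p.2 ∈ NC x n (b - p.1 + x)} := by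
    ext ω
    simp [mem_NC_succ]
  have hp : IsProbabilityMeasure (μ.map (fun ω i => X (i + 1) ω)) :=
    Measure.isProbabilityMeasure_map hZ.aemeasurable
  rw [h1, ← Measure.map_apply ((hmeas 0).prodMk hZ) hm,
    (indep_tail X hmeas hindep).map_prod_eq_prod_map_map (hmeas 0).aemeasurable hZ.aemeasurable,
    Measure.prod_apply hm, hdist 0, ← lintegral_indicator measurableSet_Iic]
  congr 1
  ext y
  by_cases hy : y ≤ b
  · rw [indicator_of_mem (by exact hy), Measure.map_apply hZ (measurable_prodMk_left hm)]
    congr 1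
    ext ω
    simp [hy]
  · rw [indicator_of_notMem (by exact hy)]
    convert measure_empty
    · ext z; simp [hy]
    · infer_instance

lemma lintegral_exp_Iic (b : ℝ) (hb : 0 ≤ b) (f : ℝ → ℝ) (hf : Continuous f)
    (hpos : ∀ y ∈ Icc 0 b, 0 ≤ f y) :
    ∫⁻ y in Iic b, ENNReal.ofReal (f y) ∂(expMeasure 1) =
      ENNReal.ofReal (∫ y in (0:ℝ)..b, exp (-y) * f y) := by
  have hpdf : Measurable (exponentialPDF 1) := (measurable_exponentialPDFReal 1).ennreal_ofReal
  have : expMeasure 1 = volume.withDensity (exponentialPDF 1) := rfl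
  rw [this, setLIntegral_withDensity_eq_setLIntegral_mul _ hpdf (by fun_prop) measurableSet_Iic,
    lintegral_Iic_eq_lintegral_Iio_add_Icc _ hb]
  have h0 : ∫⁻ y in Iio (0:ℝ), (exponentialPDF 1 * fun y => ENNReal.ofReal (f y)) y = 0 := by
    rw [setLIntegral_congr_fun measurableSet_Iio (g := fun _ => 0), lintegral_zero]
    intro y hy
    simp [exponentialPDF_of_neg (r := 1) (mem_Iio.1 hy)]
  rw [h0, zero_add, setLIntegral_congr_fun measurableSet_Icc
    (g := fun y => ENNReal.ofReal (exp (-y) * f y)), intervalIntegral.integral_of_le hb,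
    ← integral_Icc_eq_integral_Ioc, ofReal_integral_eq_lintegral_ofReal]
  · exact ContinuousOn.integrableOn_Icc (by fun_prop)
  · filter_upwards [ae_restrict_mem measurableSet_Icc] with y hy
    exact mul_nonneg (exp_pos _).le (hpos y hy)
  · intro y hy
    simp [exponentialPDF_of_nonneg (r := 1) hy.1, ENNReal.ofReal_mul (exp_pos _).le]

lemma ae_nonneg_exp : ∀ᵐ y ∂(expMeasure 1), (0:ℝ) ≤ y := by
  have hpdf : Measurable (exponentialPDF 1) := (measurable_exponentialPDFReal 1).ennreal_ofReal
  have : expMeasure 1 = volume.withDensity (exponentialPDF 1) := rfl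
  rw [this, ae_withDensity_iff hpdf]
  refine Filter.Eventually.of_forall fun y hy => ?_
  by_contra h
  exact hy (exponentialPDF_of_neg (not_le.1 h))

lemma integral_exp_neg_zero (b : ℝ) : ∫ y in (0:ℝ)..b, exp (-y) = 1 - exp (-b) := by
  simp

lemma integral_two (b t x : ℝ) (ht : t ≠ 1) : ∫ y in (0:ℝ)..b, exp (-y) * exp (-t * (b - y + x)) =
    exp (-t * x) / (1 - t) * (exp (-t * b) - exp (-b)) := by
  have h1 : (1 - t) ≠ 0 := sub_ne_zero.2 ht.symm
  rw [intervalIntegral.integral_eq_sub_of_hasDerivAt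
    (f := fun y => - (1 / (1 - t)) * exp (-t * (b + x) - (1 - t) * y))]
  · have e1 : exp (-t * (b + x) - (1 - t) * b) = exp (-t * x) * exp (-b) := by
      rw [← exp_add]; ring_nf
    have e2 : exp (-t * (b + x) - (1 - t) * 0) = exp (-t * x) * exp (-t * b) := by
      rw [← exp_add]; ring_nf
    rw [e1, e2]
    field_simp
    ring
  · intro y _
    have := (((hasDerivAt_id y).const_mul (1 - t)).const_sub (-t * (b + x))).exp.const_mul
      (- (1 / (1 - t)))
    refine this.congr_deriv ?_
    rw [← exp_add]
    simp only [id]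
    have : exp (-y + -t * (b - y + x)) = exp (-t * (b + x) - (1 - t) * y) := by ring_nf
    rw [this]
    field_simp
  · exact Continuous.intervalIntegrable (by fun_prop) _ _

lemma bounds {Ω : Type*} [MeasurableSpace Ω] {μ : Measure Ω} [IsProbabilityMeasure μ]
    (x r t ρ : ℝ) (hx : 0 < x) (hr : 0 < r) (hr1 : r < 1) (hrx : exp (-(1 - r) * x) = r)
    (ht0 : 0 ≤ t) (ht : t ≤ 1 - r) (hρ : exp (-t * x) / (1 - t) ≤ ρ) (n : ℕ) :
    ∀ (X : ℕ → Ω → ℝ) (_ : ∀ i, Measurable (X i)) (_ : iIndepFun X μ)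
    (_ : ∀ i, Measure.map (X i) μ = expMeasure 1) (b : ℝ) (_ : 0 ≤ b),
    ENNReal.ofReal (1 - exp (-(1 - r) * b)) ≤ μ {ω | (fun i => X i ω) ∈ NC x n b} ∧
    μ {ω | (fun i => X i ω) ∈ NC x n b} ≤
      ENNReal.ofReal (1 - exp (-(1 - r) * b) + ρ ^ n * exp (-t * b)) := by
  have hρ0 : 0 ≤ ρ := le_trans (div_nonneg (exp_pos _).le (by linarith)) hρ
  have hle : ∀ b : ℝ, 0 ≤ b → exp (-(1 - r) * b) ≤ 1 := fun b hb => by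
    rw [exp_le_one_iff]; nlinarith
  induction n with
  | zero =>
    intro X _ _ _ b hb
    have : {ω | (fun i => X i ω) ∈ NC x 0 b} = univ := by ext; simp [NC]
    rw [this, measure_univ]
    constructor
    · rw [ENNReal.ofReal_le_one]
      linarith [exp_pos (-(1 - r) * b)]
    · rw [ENNReal.one_le_ofReal]
      have : exp (-(1 - r) * b) ≤ exp (-t * b) := exp_le_exp.2 (by nlinarith)
      rw [pow_zero, one_mul]
      linarith
  | succ n ih =>
    intro X hmeas hindep hdist b hb
    rw [prob_succ X hmeas hindep hdist]
    have ih' := ih (fun i => X (i + 1)) (fun i => hmeas _)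
      (hindep.precomp (g := fun i => i + 1) (add_left_injective 1)) (fun i => hdist _)
    have hnn : ∀ y ∈ Icc 0 b, 0 ≤ 1 - exp (-(1 - r) * (b - y + x)) := fun y hy => by
      have := hle (b - y + x) (by linarith [hy.2])
      linarith
    have e1 : ∫ y in (0:ℝ)..b, exp (-y) * (1 - exp (-(1 - r) * (b - y + x))) =
        1 - exp (-(1 - r) * b) := by
      simp only [mul_sub, mul_one]
      rw [intervalIntegral.integral_sub, integral_exp_neg_zero, integral_two _ _ _ (by linarith), hrx]
      · have : r / (1 - (1 - r)) = 1 := by rw [sub_sub_cancel, div_self hr.ne']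
        rw [this]
        ring
      · exact Continuous.intervalIntegrable (by fun_prop) _ _
      · exact Continuous.intervalIntegrable (by fun_prop) _ _
    constructor
    · rw [← e1, ← lintegral_exp_Iic b hb _ (by fun_prop) hnn]
      refine setLIntegral_mono_ae' measurableSet_Iic ?_
      filter_upwards with y hy
      exact (ih' (b - y + x) (by have := mem_Iic.1 hy; linarith)).1
    · calc _ ≤ ∫⁻ y in Iic b, ENNReal.ofReal (1 - exp (-(1 - r) * (b - y + x)) +
              ρ ^ n * exp (-t * (b - y + x))) ∂(expMeasure 1) := by
            refine setLIntegral_mono_ae' measurableSet_Iic ?_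
            filter_upwards with y hy
            exact (ih' (b - y + x) (by have := mem_Iic.1 hy; linarith)).2
        _ = _ := lintegral_exp_Iic b hb _ (by fun_prop) fun y hy => by
            have := hnn y hy
            positivity
        _ ≤ _ := by
            refine ENNReal.ofReal_le_ofReal ?_
            have e2 : ∀ y, exp (-y) * (1 - exp (-(1 - r) * (b - y + x)) +
              ρ ^ n * exp (-t * (b - y + x))) = exp (-y) * (1 - exp (-(1 - r) * (b - y + x))) +
              ρ ^ n * (exp (-y) * exp (-t * (b - y + x))) := fun y => by ring
            simp only [e2]
            rw [intervalIntegral.integral_add, e1, intervalIntegral.integral_const_mul,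
              integral_two _ _ _ (by linarith), pow_succ, mul_assoc]
            · gcongr
              · have : exp (-b) ≤ exp (-t * b) := exp_le_exp.2 (by nlinarith)
                linarith
              · linarith [exp_pos (-b)]
            · exact Continuous.intervalIntegrable (by fun_prop) _ _
            · exact Continuous.intervalIntegrable (by fun_prop) _ _

lemma log_lt_aux {x : ℝ} (hx : 0 < x) (h1 : x ≠ 1) : log x < x - 1 :=
  log_lt_sub_one_of_pos hx h1

lemma psi_gt {r : ℝ} (hr : 0 < r) (hr1 : r < 1) : 1 < -log r / (1 - r) := by
  rw [lt_div_iff₀ (by linarith)]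
  linarith [log_lt_aux hr hr1.ne]

lemma exists_psi {x : ℝ} (hx : 1 < x) : ∃ r, 0 < r ∧ r < 1 ∧ x = -log r / (1 - r) := by
  have hx0 : 0 < x := by linarith
  have hlx := log_lt_aux hx0 hx.ne'
  have hab : exp (-x) ≤ x⁻¹ := by
    rw [← exp_log (inv_pos.2 hx0), exp_le_exp, log_inv]; linarith
  have hc : ContinuousOn (fun r => -log r - x * (1 - r)) (Icc (exp (-x)) x⁻¹) := by
    refine ContinuousOn.sub (ContinuousOn.neg (ContinuousOn.log continuousOn_id ?_)) (by fun_prop)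
    intro r hr
    exact (lt_of_lt_of_le (exp_pos _) hr.1).ne'
  have := intermediate_value_Icc' hab hc
  obtain ⟨r, hr, h⟩ := this (show (0:ℝ) ∈ _ by
    constructor
    · simp only [log_inv]
      have : x * (1 - x⁻¹) = x - 1 := by field_simp
      rw [this]; linarith
    · simp only [log_exp]
      nlinarith [exp_pos (-x)])
  have hr1 : r < 1 := lt_of_le_of_lt hr.2 (inv_lt_one_of_one_lt₀ hx)
  refine ⟨r, lt_of_lt_of_le (exp_pos _) hr.1, hr1, ?_⟩
  rw [eq_div_iff (by linarith)]
  simp only at h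
  linarith

lemma prob_eq {Ω : Type*} [MeasurableSpace Ω] {μ : Measure Ω} [IsProbabilityMeasure μ]
    (X : ℕ → Ω → ℝ) (hmeas : ∀ i, Measurable (X i)) (hindep : iIndepFun X μ)
    (hdist : ∀ i, Measure.map (X i) μ = expMeasure 1)
    (lam : ℝ) (hlam : -1 < lam) (r : ℝ) (hr : 0 < r) (hr1 : r < 1) :
    (μ {ω | ∀ k : ℕ, 1 ≤ k →
        (∑ j ∈ Finset.range k, X j ω) / (k + lam) ≤ -log r / (1 - r)}).toReal =
      1 - r ^ (1 + lam) := by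
  have hx := psi_gt hr hr1
  set x := -log r / (1 - r) with hxdef
  have hx0 : 0 < x := by linarith
  have hxr : (1 - r) * x = - log r := by
    rw [hxdef]; field_simp [(by linarith : (1 - r) ≠ 0)]
  have hrx : exp (-(1 - r) * x) = r := by rw [neg_mul, hxr, neg_neg, exp_log hr]
  set b := x * (1 + lam) with hb
  have hb0 : 0 ≤ b := mul_nonneg hx0.le (by linarith)
  have hset : {ω | ∀ k : ℕ, 1 ≤ k → (∑ j ∈ Finset.range k, X j ω) / (k + lam) ≤ x} =
      ⋂ n, {ω | (fun i => X i ω) ∈ NC x n b} := by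
    ext ω
    simp only [mem_ofPred_eq, mem_iInter, NC]
    have key : ∀ k : ℕ, (∑ j ∈ Finset.range (k + 1), X j ω) / ((k + 1 : ℕ) + lam) ≤ x ↔
        ∑ j ∈ Finset.range (k + 1), X j ω ≤ b + x * k := fun k => by
      have : (0:ℝ) ≤ k := k.cast_nonneg
      rw [div_le_iff₀ (by push_cast; linarith), hb]
      push_cast
      ring_nf
    constructor
    · intro h n k _
      exact (key k).1 (h (k + 1) (by omega))
    · intro h k hk
      obtain ⟨k, rfl⟩ := Nat.exists_eq_add_of_le' hk
      exact (key k).2 (h (k + 1) k (by omega))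
  rw [hset]
  have hXm : Measurable (fun ω i => X i ω) := measurable_pi_lambda _ hmeas
  have hlim := tendsto_measure_iInter_atTop (μ := μ)
    (s := fun n => {ω | (fun i => X i ω) ∈ NC x n b})
    (fun n => (hXm (measurableSet_NC x n b)).nullMeasurableSet)
    (fun m n hmn ω h k hk => h k (lt_of_lt_of_le hk hmn)) ⟨0, measure_ne_top _ _⟩
  have hlog := log_lt_aux hx0 hx.ne'
  have hrinv : r ≤ x⁻¹ := by
    have h1 := log_lt_aux (inv_pos.2 hr) (by rw [Ne, inv_eq_one]; exact hr1.ne)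
    rw [log_inv] at h1
    rw [le_inv_comm₀ hr hx0, hxdef, div_le_iff₀ (by linarith)]
    have : r⁻¹ * (1 - r) = r⁻¹ - 1 := by field_simp
    linarith
  have hρ : exp (-(1 - x⁻¹) * x) / (1 - (1 - x⁻¹)) < 1 := by
    rw [sub_sub_cancel, div_lt_one (inv_pos.2 hx0), ← exp_log (inv_pos.2 hx0), exp_lt_exp, log_inv,
      exp_neg, exp_log hx0]
    have : -(1 - x⁻¹) * x = 1 - x := by field_simp; ring
    linarith
  have hinv1 : x⁻¹ < 1 := inv_lt_one_of_one_lt₀ hx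
  have hρ0 : 0 ≤ exp (-(1 - x⁻¹) * x) / (1 - (1 - x⁻¹)) := by
    rw [sub_sub_cancel]; positivity
  have hbd := fun n => bounds (μ := μ) x r (1 - x⁻¹) _ hx0 hr hr1 hrx (by linarith) (by linarith)
    le_rfl n X hmeas hindep hdist b hb0
  have hpow := (tendsto_pow_atTop_nhds_zero_of_lt_one hρ0 hρ)
  have hup := ENNReal.tendsto_ofReal (((hpow.mul_const (exp (-(1 - x⁻¹) * b))).const_add
    (1 - exp (-(1 - r) * b))))
  rw [zero_mul, add_zero] at hup
  have hlim2 := tendsto_of_tendsto_of_tendsto_of_le_of_le tendsto_const_nhds hup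
    (fun n => (hbd n).1) (fun n => (hbd n).2)
  rw [tendsto_nhds_unique hlim hlim2]
  have e : exp (-(1 - r) * b) = r ^ (1 + lam) := by
    rw [rpow_def_of_pos hr, hb]
    congr 1
    linear_combination (-(1 + lam)) * hxr
  rw [e, ENNReal.toReal_ofReal]
  have := rpow_le_one hr.le hr1.le (by linarith : 0 ≤ 1 + lam)
  linarith

/-- If `(X i)` are i.i.d. exponential random variables with mean 1, `lam > -1` and
`Z_{∞;lam} = sup{(X_1 + ⋯ + X_k)/(k + lam) : k ≥ 1}` with CDF `F_{∞;lam}`, then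
`F_{∞;lam}` restricted to `(1, ∞)` is a bijection onto `(0, 1)`, and its inverse is
`u ↦ (-log(1-u)) / ((1+lam)(1 - (1-u)^{1/(1+lam)}))` on `(0, 1)`. -/
theorem shiftedSup_cdf_bijOn_inverse
    {Ω : Type*} [MeasureSpace Ω] [IsProbabilityMeasure (ℙ : Measure Ω)]
    (X : ℕ → Ω → ℝ) (hmeas : ∀ i, Measurable (X i))
    (hindep : iIndepFun X ℙ)
    (hdist : ∀ i, Measure.map (X i) ℙ = expMeasure 1)
    (lam : ℝ) (hlam : -1 < lam)
    (F : ℝ → ℝ)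
    (hF : ∀ x : ℝ, F x =
      (ℙ {ω | ∀ k : ℕ, 1 ≤ k →
        (∑ j ∈ Finset.range k, X j ω) / (k + lam) ≤ x}).toReal) :
    BijOn F (Ioi 1) (Ioo 0 1) ∧
    ∀ u ∈ Ioo (0 : ℝ) 1,
      F ((-Real.log (1 - u)) / ((1 + lam) * (1 - (1 - u) ^ (1 / (1 + lam))))) = u := by
  have ha : 0 < 1 + lam := by linarith
  have key : ∀ r, 0 < r → r < 1 → F (-Real.log r / (1 - r)) = 1 - r ^ (1 + lam) :=
    fun r hr hr1 => by rw [hF]; exact prob_eq X hmeas hindep hdist lam hlam r hr hr1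
  have hG : ∀ u ∈ Ioo (0 : ℝ) 1, ∃ r, 0 < r ∧ r < 1 ∧ r ^ (1 + lam) = 1 - u ∧
      (-Real.log (1 - u)) / ((1 + lam) * (1 - (1 - u) ^ (1 / (1 + lam)))) =
        -Real.log r / (1 - r) := by
    intro u hu
    have h0 : 0 < 1 - u := by linarith [hu.2]
    refine ⟨(1 - u) ^ (1 / (1 + lam)), rpow_pos_of_pos h0 _,
      rpow_lt_one h0.le (by linarith [hu.1]) (by positivity), ?_, ?_⟩
    · rw [← rpow_mul h0.le, one_div_mul_cancel ha.ne', rpow_one]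
    · rw [log_rpow h0, ← div_div]
      congr 1
      field_simp
  have hinv : ∀ u ∈ Ioo (0 : ℝ) 1,
      F ((-Real.log (1 - u)) / ((1 + lam) * (1 - (1 - u) ^ (1 / (1 + lam))))) = u := by
    intro u hu
    obtain ⟨r, hr, hr1, hru, e⟩ := hG u hu
    rw [e, key r hr hr1, hru]
    ring
  refine ⟨⟨?_, ?_, ?_⟩, hinv⟩
  · intro x hx
    obtain ⟨r, hr, hr1, rfl⟩ := exists_psi hx
    rw [key r hr hr1]
    have h1 := rpow_pos_of_pos hr (1 + lam)
    have h2 := rpow_lt_one hr.le hr1 ha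
    exact ⟨by linarith, by linarith⟩
  · intro x hx x' hx' h
    obtain ⟨r, hr, hr1, rfl⟩ := exists_psi hx
    obtain ⟨s, hs, hs1, rfl⟩ := exists_psi hx'
    rw [key r hr hr1, key s hs hs1] at h
    have : r = s := (rpow_left_inj hr.le hs.le ha.ne').1 (by linarith)
    rw [this]
  · intro u hu
    obtain ⟨r, hr, hr1, hru, e⟩ := hG u hu
    refine ⟨_, ?_, hinv u hu⟩
    rw [e]
    exact psi_gt hr hr1
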